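/- arXiv:2403.03895 — 10 statements merged into one kernel-verified Lean document; each statement's English description precedes it below -/
import Mathlib

section
/- Let N be a natural number, let φ be a polynomial with complex coefficients of degree at most N, and let s ∈ ℂ. Define the polynomial q_s(θ) = Σ_{k=0}^N φ^{(N−k)}(θ) s^k, where φ^{(m)} denotes the m-th derivative of φ. Then the polynomial identity q_s′(θ) = s·q_s(θ) − s^{N+1}·φ(θ) holds. -/
open Polynomial

/-- For a complex polynomial `φ` of degree at most `N` and `s : ℂ`,
the polynomial `q_s(θ) = ∑_{k=0}^N φ^{(N-k)}(θ) s^k` satisfies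
`q_s' = s·q_s - s^{N+1}·φ`. -/
theorem tau_derivative_identity (N : ℕ) (φ : Polynomial ℂ) (hφ : φ.natDegree ≤ N) (s : ℂ) :
    derivative (∑ k ∈ Finset.range (N + 1), C (s ^ k) * derivative^[N - k] φ) =
      C s * (∑ k ∈ Finset.range (N + 1), C (s ^ k) * derivative^[N - k] φ) -
        C (s ^ (N + 1)) * φ := by
  have h_top : derivative (derivative^[N] φ) = 0 := by
    rw [← Function.iterate_succ_apply' (⇑derivative)]
    exact iterate_derivative_eq_zero (Nat.lt_succ_of_le hφ)
  have h_shift : ∀ k ∈ Finset.range N,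
      C (s ^ (k + 1)) * derivative (derivative^[N - (k + 1)] φ) =
        C s * (C (s ^ k) * derivative^[N - k] φ) := by
    intro k hk
    rw [← Function.iterate_succ_apply' (⇑derivative), Nat.succ_eq_add_one,
      show N - (k + 1) + 1 = N - k by have := Finset.mem_range.mp hk; omega,
      pow_succ', C_mul, mul_assoc]
  simp only [derivative_sum, derivative_C_mul]
  rw [Finset.sum_range_succ', Nat.sub_zero, h_top, mul_zero, add_zero,
    Finset.sum_congr rfl h_shift, ← Finset.mul_sum, Finset.sum_range_succ, Nat.sub_self,
    Function.iterate_zero_apply, pow_succ', C_mul]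
  ring
end

section
/- For every s ∈ ℂ, a complex polynomial p of degree at most N satisfies the polynomial identity p′ = s·T_{N−1} p, i.e. p′(θ) = s·[p(θ) − (⟨p, φ⟩_w/‖φ‖_w²)·φ(θ)], if and only if p = c·q_s for some c ∈ ℂ. In other words, the solution set of the Lanczos tau equation p′ = s T_{N−1} p in polynomials of degree at most N is exactly the one-dimensional space spanned by q_s. -/
open Polynomial MeasureTheory

/-- The complexified pairing of a combination of real polynomials against `φ` with weight `w`. -/
theorem integral_sum_map_mul_weight {a b : ℝ} {w : ℝ → ℝ} {ι : Type*} (t : Finset ι)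
    (hint : ∀ g : Polynomial ℝ, IntervalIntegrable (fun θ => g.eval θ * w θ) volume a b)
    (φ : Polynomial ℝ) (c : ι → ℂ) (g : ι → Polynomial ℝ) :
    (∫ θ in a..b, (∑ k ∈ t, C (c k) * (g k).map (algebraMap ℝ ℂ)).eval ((θ : ℝ) : ℂ) *
        ((φ.eval θ : ℝ) : ℂ) * ((w θ : ℝ) : ℂ)) =
      ∑ k ∈ t, c k * ((∫ θ in a..b, (g k).eval θ * φ.eval θ * w θ : ℝ) : ℂ) := by
  have h : ∀ k, IntervalIntegrable
      (fun θ => (((g k).eval θ * φ.eval θ * w θ : ℝ) : ℂ)) volume a b := fun k => by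
    have := hint (g k * φ)
    simp only [eval_mul] at this
    exact ⟨this.1.ofReal, this.2.ofReal⟩
  simp_rw [← intervalIntegral.integral_ofReal, ← intervalIntegral.integral_const_mul]
  rw [← intervalIntegral.integral_finsetSum fun k _ => (h k).const_mul (c k)]
  refine intervalIntegral.integral_congr fun θ _ => ?_
  have he : ∀ k, ((g k).map (algebraMap ℝ ℂ)).eval (θ : ℂ) = (((g k).eval θ : ℝ) : ℂ) :=
    fun k => by
      rw [eval_map_algebraMap]; exact aeval_algebraMap_apply_eq_algebraMap_eval θ (g k)
  simp only [eval_finsetSum, eval_mul, eval_C, he, Finset.sum_mul, Complex.ofReal_mul, mul_assoc]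

/-- The polynomial `∑ φ^{(N-k)} s^k` solves `q' = s (q - s^N φ)` when `φ` has degree `N`. -/
theorem derivative_sum_iterate_derivative {R S : Type*} [CommRing R] [CommRing S] (f : R →+* S)
    (φ : Polynomial R) (s : S) {N : ℕ} (hφ : φ.natDegree ≤ N) :
    derivative (∑ k ∈ Finset.range (N + 1), C (s ^ k) * (derivative^[N - k] φ).map f) =
      C s * ((∑ k ∈ Finset.range (N + 1), C (s ^ k) * (derivative^[N - k] φ).map f) -
        C (s ^ N) * φ.map f) := by
  have hlast : (∑ k ∈ Finset.range (N + 1), C (s ^ k) * (derivative^[N - k] φ).map f) -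
      C (s ^ N) * φ.map f = ∑ k ∈ Finset.range N, C (s ^ k) * (derivative^[N - k] φ).map f := by
    simp [Finset.sum_range_succ]
  rw [hlast, derivative_sum, Finset.sum_range_succ', Finset.mul_sum]
  have h0 : derivative (C (s ^ 0) * (derivative^[N - 0] φ).map f) = 0 := by
    rw [derivative_C_mul, derivative_map, ← Function.iterate_succ_apply' derivative,
      iterate_derivative_eq_zero (by omega), Polynomial.map_zero, mul_zero]
  rw [h0, add_zero]
  refine Finset.sum_congr rfl fun k hk => ?_
  have hk := Finset.mem_range.1 hk
  rw [derivative_C_mul, derivative_map, ← Function.iterate_succ_apply' derivative,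
    show (N - (k + 1)).succ = N - k by omega, pow_succ', C_mul, mul_assoc]

/-- A nonzero polynomial is not an eigenvector of the derivative for a nonzero eigenvalue. -/
theorem eq_zero_of_derivative_eq_C_mul {R : Type*} [CommRing R] [IsDomain R] {r : Polynomial R}
    {s : R} (hs : s ≠ 0) (h : derivative r = C s * r) : r = 0 := by
  by_contra hr
  have := degree_derivative_lt hr
  rw [h, degree_C_mul hs] at this
  exact lt_irrefl _ this

/-- With `φ` a real polynomial of degree exactly `N ≥ 1`, orthogonal to all
polynomials of degree `< N` w.r.t. the weight `w` on `[-τ, 0]`, and with positive norm: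
a complex polynomial `p` of degree at most `N` satisfies the Lanczos tau equation
`p' = s·T_{N-1} p = s·(p - (⟨p,φ⟩_w/‖φ‖_w²)·φ)` if and only if `p` is a scalar multiple of
`q_s(θ) = ∑_{k=0}^N φ^{(N-k)}(θ) s^k`. -/
theorem tau_equation_solutions (τ : ℝ) (hτ : 0 < τ) (N : ℕ) (hN : 1 ≤ N)
    (w : ℝ → ℝ) (hw : ∀ θ ∈ Set.Icc (-τ) 0, 0 ≤ w θ)
    (hint : ∀ g : Polynomial ℝ,
      IntervalIntegrable (fun θ => g.eval θ * w θ) volume (-τ) 0)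
    (φ : Polynomial ℝ) (hφdeg : φ.natDegree = N)
    (horth : ∀ g : Polynomial ℝ, g.natDegree < N →
      ∫ θ in (-τ)..0, g.eval θ * φ.eval θ * w θ = 0)
    (hnorm : 0 < ∫ θ in (-τ)..0, φ.eval θ ^ 2 * w θ)
    (s : ℂ) (p : Polynomial ℂ) (hp : p.natDegree ≤ N) :
    (derivative p = C s *
        (p - C ((∫ θ in (-τ)..0, p.eval ((θ : ℝ) : ℂ) * ((φ.eval θ : ℝ) : ℂ) * ((w θ : ℝ) : ℂ)) /
            ((∫ θ in (-τ)..0, φ.eval θ ^ 2 * w θ : ℝ) : ℂ)) * φ.map (algebraMap ℝ ℂ)))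
      ↔ ∃ c : ℂ, p = C c *
          ∑ k ∈ Finset.range (N + 1), C (s ^ k) * (derivative^[N - k] φ).map (algebraMap ℝ ℂ) := by
  set I : ℝ := ∫ θ in (-τ)..0, φ.eval θ ^ 2 * w θ with hI
  have hI0 : (I : ℂ) ≠ 0 := by exact_mod_cast hnorm.ne'
  set q := ∑ k ∈ Finset.range (N + 1), C (s ^ k) * (derivative^[N - k] φ).map (algebraMap ℝ ℂ)
    with hq
  have hq' : derivative q = C s * (q - C (s ^ N) * φ.map (algebraMap ℝ ℂ)) :=
    derivative_sum_iterate_derivative _ φ s hφdeg.le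
  have hφ : φ ≠ 0 := by rintro rfl; simp at hφdeg; omega
  constructor
  · intro h
    set a := (∫ θ in (-τ)..0, p.eval ((θ : ℝ) : ℂ) * ((φ.eval θ : ℝ) : ℂ) * ((w θ : ℝ) : ℂ)) /
      (I : ℂ)
    by_cases hs : s = 0
    · subst hs
      rw [C_0, zero_mul] at h hq'
      have hq0 : q.coeff 0 ≠ 0 := by
        rw [hq, Finset.sum_eq_single_of_mem 0 (by simp) fun k _ hk => by simp [hk]]
        simp [coeff_iterate_derivative, ← hφdeg, Nat.descFactorial_self, Nat.factorial_ne_zero, hφ]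
      refine ⟨p.coeff 0 / q.coeff 0, ?_⟩
      rw [eq_C_of_derivative_eq_zero hq', eq_C_of_derivative_eq_zero h, ← C_mul]
      simp [div_mul_cancel₀ _ hq0]
    · refine ⟨a / s ^ N, sub_eq_zero.1 (eq_zero_of_derivative_eq_C_mul hs ?_)⟩
      have hc : C (a / s ^ N) * C (s ^ N) = C a := by
        rw [← C_mul, div_mul_cancel₀ _ (pow_ne_zero _ hs)]
      rw [derivative_sub, derivative_C_mul, h, hq']
      linear_combination C s * φ.map (algebraMap ℝ ℂ) * hc
  · rintro ⟨c, rfl⟩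
    have hL : (∫ θ in (-τ)..0, (C c * q).eval ((θ : ℝ) : ℂ) * ((φ.eval θ : ℝ) : ℂ) *
        ((w θ : ℝ) : ℂ)) = c * s ^ N * I := by
      have hcq : C c * q = ∑ k ∈ Finset.range (N + 1),
          C (c * s ^ k) * (derivative^[N - k] φ).map (algebraMap ℝ ℂ) := by
        simp only [hq, Finset.mul_sum, C_mul, mul_assoc]
      rw [hcq, integral_sum_map_mul_weight _ hint, Finset.sum_range_succ,
        Finset.sum_eq_zero fun k hk => ?_, zero_add]
      · simp [hI, sq]
      · have hk := Finset.mem_range.1 hk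
        rw [horth _ ((natDegree_iterate_derivative φ _).trans_lt (by omega)), Complex.ofReal_zero,
          mul_zero]
    rw [hL, mul_div_cancel_right₀ _ hI0, derivative_C_mul, hq', C_mul]
    ring
end

section
/- Assume in addition that φ has N distinct real roots θ_0 < θ_1 < ⋯ < θ_{N−1}. Then for every s ∈ ℂ and every complex polynomial p of degree at most N, the polynomial identity p′ = s·T_{N−1} p holds if and only if p′(θ_k) = s·p(θ_k) for every k = 0, …, N−1. That is, the Lanczos tau condition is equivalent to collocation of the equation p′ = s p at the zeroes of φ. -/
open Polynomial MeasureTheory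

/-- The complex coercion of an interval integrable real function is interval integrable. -/
theorem IntervalIntegrable.complex_ofReal {μ : Measure ℝ} {a b : ℝ} {f : ℝ → ℝ}
    (hf : IntervalIntegrable f μ a b) : IntervalIntegrable (fun x => (f x : ℂ)) μ a b :=
  ⟨hf.1.ofReal, hf.2.ofReal⟩

/-- A complex polynomial of degree less than `N` is annihilated by a moment functional
`g ↦ ∫ g v` that vanishes on real polynomials of degree less than `N`. -/
theorem integral_eval_mul_ofReal_eq_zero {a b : ℝ} {N : ℕ} {v : ℝ → ℝ}
    (hint : ∀ g : Polynomial ℝ, IntervalIntegrable (fun θ => g.eval θ * v θ) volume a b)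
    (horth : ∀ g : Polynomial ℝ, g.natDegree < N → ∫ θ in a..b, g.eval θ * v θ = 0)
    (q : Polynomial ℂ) (hq : q.degree < N) :
    ∫ θ in a..b, q.eval (θ : ℂ) * (v θ : ℂ) = 0 := by
  have hterm (i : ℕ) (θ : ℝ) : q.coeff i * (θ : ℂ) ^ i * (v θ : ℂ)
      = q.coeff i * (((X ^ i : Polynomial ℝ).eval θ * v θ : ℝ) : ℂ) := by
    simp [mul_assoc]
  have hsum (θ : ℝ) : q.eval (θ : ℂ) * (v θ : ℂ) = ∑ i ∈ Finset.range N,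
      q.coeff i * (((X ^ i : Polynomial ℝ).eval θ * v θ : ℝ) : ℂ) := by
    rcases eq_or_ne q 0 with rfl | hq0
    · simp
    rw [eval_eq_sum_range' ((natDegree_lt_iff_degree_lt hq0).2 hq), Finset.sum_mul]
    exact Finset.sum_congr rfl fun i _ => hterm i θ
  simp_rw [hsum]
  rw [intervalIntegral.integral_finsetSum fun i _ => (hint (X ^ i)).complex_ofReal.const_mul _]
  refine Finset.sum_eq_zero fun i hi => ?_
  rw [intervalIntegral.integral_const_mul, intervalIntegral.integral_ofReal,
    horth _ (by simpa using hi)]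
  simp

/-- Integrability of the real moments of `v` gives integrability of its complex moments. -/
theorem intervalIntegrable_eval_mul_ofReal {a b : ℝ} {v : ℝ → ℝ}
    (hint : ∀ g : Polynomial ℝ, IntervalIntegrable (fun θ => g.eval θ * v θ) volume a b)
    (q : Polynomial ℂ) :
    IntervalIntegrable (fun θ : ℝ => q.eval (θ : ℂ) * (v θ : ℂ)) volume a b := by
  induction q using Polynomial.induction_on' with
  | add p q hp hq => simpa only [eval_add, add_mul] using hp.add hq
  | monomial n c =>
    simpa [mul_assoc] using (hint (X ^ n)).complex_ofReal.const_mul c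

/-- Subtracting a suitable multiple of `φ` from a polynomial of degree at most `φ.natDegree`
lowers the degree below `φ.natDegree`. -/
theorem exists_degree_sub_C_mul_lt {K : Type*} [Field K] {φ p : Polynomial K} (hφ : φ ≠ 0)
    (hp : p.natDegree ≤ φ.natDegree) :
    ∃ c : K, (p - C c * φ).degree < (φ.natDegree : WithBot ℕ) := by
  refine ⟨p.coeff φ.natDegree / φ.leadingCoeff, ?_⟩
  rw [degree_lt_iff_coeff_zero]
  intro m hm
  rcases hm.eq_or_lt with rfl | hm
  · simp [div_mul_cancel₀ _ (leadingCoeff_ne_zero.2 hφ)]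
  · simp [coeff_eq_zero_of_natDegree_lt hm, coeff_eq_zero_of_natDegree_lt (hp.trans_lt hm)]

/-- The truncation of a polynomial of degree at most `φ.natDegree` along the orthogonal
polynomial `φ` has degree less than `φ.natDegree`. -/
theorem degree_truncation_lt {a b : ℝ} {w : ℝ → ℝ} {φ : Polynomial ℝ}
    (hint : ∀ g : Polynomial ℝ, IntervalIntegrable (fun θ => g.eval θ * w θ) volume a b)
    (horth : ∀ g : Polynomial ℝ, g.natDegree < φ.natDegree →
      ∫ θ in a..b, g.eval θ * φ.eval θ * w θ = 0)
    (hnorm : 0 < ∫ θ in a..b, φ.eval θ ^ 2 * w θ)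
    (p : Polynomial ℂ) (hp : p.natDegree ≤ φ.natDegree) :
    (p - C ((∫ θ in a..b, p.eval (θ : ℂ) * ((φ.eval θ : ℝ) : ℂ) * (w θ : ℂ)) /
      ((∫ θ in a..b, φ.eval θ ^ 2 * w θ : ℝ) : ℂ)) * φ.map (algebraMap ℝ ℂ)).degree
      < φ.natDegree := by
  set Φ := φ.map (algebraMap ℝ ℂ) with hΦ
  have hΦdeg : Φ.natDegree = φ.natDegree := natDegree_map _
  have hφ0 : φ ≠ 0 := by
    rintro rfl
    simp at hnorm
  have hΦ0 : Φ ≠ 0 := by simpa [hΦ] using hφ0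
  obtain ⟨c, hdeg⟩ := exists_degree_sub_C_mul_lt hΦ0 (hp.trans_eq hΦdeg.symm)
  rw [hΦdeg] at hdeg
  have hint' (g : Polynomial ℝ) :
      IntervalIntegrable (fun θ => g.eval θ * (φ.eval θ * w θ)) volume a b := by
    simpa [mul_assoc] using hint (g * φ)
  have horth' (g : Polynomial ℝ) (hg : g.natDegree < φ.natDegree) :
      ∫ θ in a..b, g.eval θ * (φ.eval θ * w θ) = 0 := by
    simpa only [mul_assoc] using horth g hg
  have hzero := integral_eval_mul_ofReal_eq_zero hint' horth' (p - C c * Φ) hdeg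
  have hsq : ∫ θ in a..b, (C c * Φ).eval (θ : ℂ) * ((φ.eval θ * w θ : ℝ) : ℂ)
      = c * ((∫ θ in a..b, φ.eval θ ^ 2 * w θ : ℝ) : ℂ) := by
    rw [← intervalIntegral.integral_ofReal, ← intervalIntegral.integral_const_mul]
    congr 1 with θ
    have : Φ.eval (θ : ℂ) = ((φ.eval θ : ℝ) : ℂ) := eval_map_apply (algebraMap ℝ ℂ) θ
    simp only [eval_mul, eval_C, this]
    push_cast
    ring
  simp only [eval_sub, sub_mul] at hzero
  rw [intervalIntegral.integral_sub (intervalIntegrable_eval_mul_ofReal hint' _)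
    (intervalIntegrable_eval_mul_ofReal hint' _), hsq, sub_eq_zero] at hzero
  simp only [Complex.ofReal_mul, ← mul_assoc] at hzero
  have hne := Complex.ofReal_ne_zero.2 hnorm.ne'
  rwa [hzero, mul_div_cancel_right₀ _ hne]

/-- With `φ` a real polynomial of degree exactly `N ≥ 1`, orthogonal to all
polynomials of degree `< N` w.r.t. the weight `w` on `[-τ, 0]`, positive norm, and such that
`φ` has `N` distinct real roots `θ_0 < ⋯ < θ_{N-1}`: for every `s : ℂ` and every complex
polynomial `p` of degree at most `N`, the Lanczos tau identity `p' = s·T_{N-1} p` holds if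
and only if `p'(θ_k) = s·p(θ_k)` for every `k` (collocation at the zeroes of `φ`). -/
theorem tau_equals_collocation (τ : ℝ) (hτ : 0 < τ) (N : ℕ) (hN : 1 ≤ N)
    (w : ℝ → ℝ) (hw : ∀ θ ∈ Set.Icc (-τ) 0, 0 ≤ w θ)
    (hint : ∀ g : Polynomial ℝ,
      IntervalIntegrable (fun θ => g.eval θ * w θ) volume (-τ) 0)
    (φ : Polynomial ℝ) (hφdeg : φ.natDegree = N)
    (horth : ∀ g : Polynomial ℝ, g.natDegree < N →
      ∫ θ in (-τ)..0, g.eval θ * φ.eval θ * w θ = 0)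
    (hnorm : 0 < ∫ θ in (-τ)..0, φ.eval θ ^ 2 * w θ)
    (node : Fin N → ℝ) (hmono : StrictMono node) (hroots : ∀ k, φ.eval (node k) = 0)
    (s : ℂ) (p : Polynomial ℂ) (hp : p.natDegree ≤ N) :
    (derivative p = C s *
        (p - C ((∫ θ in (-τ)..0, p.eval ((θ : ℝ) : ℂ) * ((φ.eval θ : ℝ) : ℂ) * ((w θ : ℝ) : ℂ)) /
            ((∫ θ in (-τ)..0, φ.eval θ ^ 2 * w θ : ℝ) : ℂ)) * φ.map (algebraMap ℝ ℂ)))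
      ↔ ∀ k : Fin N, (derivative p).eval ((node k : ℝ) : ℂ) = s * p.eval ((node k : ℝ) : ℂ) := by
  subst hφdeg
  have hT := degree_truncation_lt hint horth hnorm p hp
  set c := (∫ θ in (-τ)..0, p.eval ((θ : ℝ) : ℂ) * ((φ.eval θ : ℝ) : ℂ) * ((w θ : ℝ) : ℂ)) /
    ((∫ θ in (-τ)..0, φ.eval θ ^ 2 * w θ : ℝ) : ℂ)
  have heval (k) : (C s * (p - C c * φ.map (algebraMap ℝ ℂ))).eval (node k : ℂ)
      = s * p.eval (node k : ℂ) := by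
    have : (φ.map (algebraMap ℝ ℂ)).eval (node k : ℂ) = ((φ.eval (node k) : ℝ) : ℂ) :=
      eval_map_apply (algebraMap ℝ ℂ) (node k)
    simp [this, hroots k]
  refine ⟨fun h k => by rw [h, heval], fun h => ?_⟩
  have hder : (derivative p).degree < φ.natDegree := by
    rcases eq_or_ne p 0 with rfl | hp0
    · simp
    exact (degree_derivative_lt hp0).trans_le (degree_le_of_natDegree_le hp)
  have hinj : Function.Injective fun k => (node k : ℂ) :=
    Complex.ofReal_injective.comp hmono.injective
  refine eq_of_degrees_lt_of_eval_index_eq Finset.univ hinj.injOn (by simpa using hder) ?_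
    fun k _ => by rw [h, heval]
  rw [Finset.card_fin, ← smul_eq_C_mul]
  exact (degree_smul_le _ _).trans_lt hT
end

section
/- Let N ≥ 1 be an integer, let θ_0, …, θ_{N−1} be N distinct complex numbers, and let s ∈ ℂ. Then the set of complex polynomials p of degree at most N satisfying p′(θ_k) = s·p(θ_k) for all k = 0, …, N−1 is a one-dimensional ℂ-vector subspace of the space of polynomials of degree at most N. -/
open Polynomial

theorem exists_derivative_sub_C_mul_eq {K : Type*} [Field K] {s : K} (hs : s ≠ 0) (n : ℕ)
    (q : K[X]) (hq : q.natDegree ≤ n) :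
    ∃ p : K[X], p.natDegree ≤ n ∧ derivative p - C s * p = q := by
  have hC : C s * C s⁻¹ = 1 := by rw [← C_mul, mul_inv_cancel₀ hs, C_1]
  induction n generalizing q with
  | zero =>
    refine ⟨-(C s⁻¹ * q), by simpa using (natDegree_C_mul_le _ _).trans hq, ?_⟩
    have hd : derivative q = 0 := derivative_of_natDegree_zero (Nat.le_zero.mp hq)
    simp only [derivative_neg, derivative_C_mul, hd]
    linear_combination q * hC
  | succ n ih =>
    obtain ⟨r, hr, hrq⟩ := ih (C s⁻¹ * derivative q)
      ((natDegree_C_mul_le _ _).trans ((natDegree_derivative_le q).trans (by omega)))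
    refine ⟨r - C s⁻¹ * q, ?_, ?_⟩
    · exact (natDegree_sub_le _ _).trans
        (max_le (hr.trans n.le_succ) ((natDegree_C_mul_le _ _).trans hq))
    · simp only [derivative_sub, derivative_C_mul]
      linear_combination hrq + q * hC

theorem eq_zero_of_derivative_eq_C_mul_s5 {K : Type*} [Field K] {s : K} (hs : s ≠ 0) {p : K[X]}
    (hp : derivative p = C s * p) : p = 0 := by
  by_contra h
  have hlt := degree_derivative_lt h
  rw [hp, degree_C_mul hs] at hlt
  exact lt_irrefl _ hlt

theorem exists_eq_C_mul_nodal {K ι : Type*} [Field K] [Fintype ι] {node : ι → K}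
    (hnode : Function.Injective node) {q : K[X]} (hdeg : q.natDegree ≤ Fintype.card ι)
    (hq : ∀ i, q.eval (node i) = 0) : ∃ c : K, q = C c * Lagrange.nodal Finset.univ node := by
  obtain ⟨r, rfl⟩ : Lagrange.nodal Finset.univ node ∣ q :=
    Finset.prod_dvd_of_coprime ((pairwise_coprime_X_sub_C hnode).set_pairwise _)
      fun i _ => dvd_iff_isRoot.mpr (hq i)
  rcases eq_or_ne r 0 with rfl | hr
  · exact ⟨0, by simp⟩
  · rw [(Lagrange.nodal_monic).natDegree_mul' hr, Lagrange.natDegree_nodal,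
      Finset.card_univ] at hdeg
    refine ⟨r.coeff 0, ?_⟩
    rw [← eq_C_of_natDegree_le_zero (by omega), mul_comm]

/-- For `N ≥ 1` distinct complex nodes `θ_0, …, θ_{N-1}` and any `s : ℂ`,
the set of complex polynomials `p` of degree at most `N` with `p'(θ_k) = s·p(θ_k)` for all
`k` is a one-dimensional ℂ-subspace of the polynomials of degree at most `N`: it is the
span of a single nonzero polynomial `p₀`. -/
theorem collocation_solution_space_one_dimensional (N : ℕ) (hN : 1 ≤ N)
    (node : Fin N → ℂ) (hnode : Function.Injective node) (s : ℂ) :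
    ∃ p₀ : Polynomial ℂ, p₀ ≠ 0 ∧ p₀.natDegree ≤ N ∧
      (∀ k : Fin N, (derivative p₀).eval (node k) = s * p₀.eval (node k)) ∧
      ∀ p : Polynomial ℂ,
        (p.natDegree ≤ N ∧ ∀ k : Fin N, (derivative p).eval (node k) = s * p.eval (node k))
          ↔ ∃ c : ℂ, p = C c * p₀ := by
  suffices h : ∃ p₀ : Polynomial ℂ, p₀ ≠ 0 ∧ p₀.natDegree ≤ N ∧
      (∀ k : Fin N, (derivative p₀).eval (node k) = s * p₀.eval (node k)) ∧
      ∀ p : Polynomial ℂ, p.natDegree ≤ N →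
        (∀ k : Fin N, (derivative p).eval (node k) = s * p.eval (node k)) →
          ∃ c : ℂ, p = C c * p₀ by
    obtain ⟨p₀, h0, hdeg, hev, hspan⟩ := h
    refine ⟨p₀, h0, hdeg, hev, fun p => ⟨fun hp => hspan p hp.1 hp.2, ?_⟩⟩
    rintro ⟨c, rfl⟩
    refine ⟨(natDegree_C_mul_le _ _).trans hdeg, fun k => ?_⟩
    rw [derivative_C_mul, eval_C_mul, eval_C_mul, hev k]
    ring
  rcases eq_or_ne s 0 with rfl | hs
  · refine ⟨1, one_ne_zero, by simp, by simp, fun p hdeg hp => ⟨p.coeff 0, ?_⟩⟩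
    have hd : derivative p = 0 :=
      eq_zero_of_natDegree_lt_card_of_eval_eq_zero _ hnode (fun k => by simpa using hp k) (by
        have := natDegree_derivative_le p
        rw [Fintype.card_fin]
        omega)
    rw [mul_one]
    exact eq_C_of_derivative_eq_zero hd
  · obtain ⟨p₀, hdeg, hp₀⟩ := exists_derivative_sub_C_mul_eq hs N
      (Lagrange.nodal Finset.univ node) (by simp [Lagrange.natDegree_nodal])
    refine ⟨p₀, ?_, hdeg, fun k => ?_, fun p hpdeg hp => ?_⟩
    · rintro rfl
      exact Lagrange.nodal_ne_zero (by simpa using hp₀.symm)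
    · have h := congrArg (eval (node k)) hp₀
      rw [Lagrange.eval_nodal_at_node (Finset.mem_univ k), eval_sub, eval_C_mul] at h
      exact sub_eq_zero.mp h
    · obtain ⟨c, hc⟩ := exists_eq_C_mul_nodal hnode (q := derivative p - C s * p)
        (by
          rw [Fintype.card_fin]
          exact (natDegree_sub_le _ _).trans (max_le
            ((natDegree_derivative_le p).trans ((Nat.sub_le _ _).trans hpdeg))
            ((natDegree_C_mul_le _ _).trans hpdeg)))
        (fun k => by rw [eval_sub, eval_C_mul, hp k, sub_self])
      refine ⟨c, sub_eq_zero.mp (eq_zero_of_derivative_eq_C_mul_s5 hs ?_)⟩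
      simp only [derivative_sub, derivative_C_mul]
      linear_combination hc - C c * hp₀
end

section
/- Let N ≥ 1 be an integer. Define the operator M_N on real polynomials by (M_N f)(θ) = ∫_0^θ [f(ξ) − (⟨f, P_N⟩/⟨P_N, P_N⟩)·P_N(ξ)] dξ. Then for every integer n with 0 ≤ n ≤ 2N, the n-fold iterate of M_N applied to the constant polynomial 1 satisfies n!·(M_N^n 1)(−τ) = (−τ)^n. -/
open Polynomial

/-- The standard Legendre polynomial of degree `k` (Rodrigues' formula),
shifted to the interval `[-τ, 0]`: `P_k(θ) = L_k(2θ/τ + 1)` where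
`L_k(x) = (1/(2^k k!)) dᵏ/dxᵏ[(x² − 1)^k]`. -/
noncomputable def shiftedLegendre (τ : ℝ) (k : ℕ) : Polynomial ℝ :=
  (C (((2 : ℝ) ^ k * k.factorial)⁻¹) * derivative^[k] ((X ^ 2 - 1) ^ k)).comp
    (C (2 / τ) * X + C 1)

/-- The operator `M_N`: `(M_N f)(θ) = ∫_0^θ [f(ξ) − (⟨f, P_N⟩/⟨P_N, P_N⟩)·P_N(ξ)] dξ`,
with `⟨f, g⟩ = ∫_{-τ}^0 f g`. -/
noncomputable def legendreTauIntOp (τ : ℝ) (N : ℕ) (f : ℝ → ℝ) : ℝ → ℝ :=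
  fun θ => ∫ ξ in (0 : ℝ)..θ,
    (f ξ - ((∫ x in (-τ)..(0 : ℝ), f x * (shiftedLegendre τ N).eval x) /
        (∫ x in (-τ)..(0 : ℝ), (shiftedLegendre τ N).eval x * (shiftedLegendre τ N).eval x)) *
      (shiftedLegendre τ N).eval ξ)

theorem iterate_derivative_comp_linear {R : Type*} [CommSemiring R] (p : R[X]) (c d : R) (k : ℕ) :
    derivative^[k] (p.comp (C c * X + C d)) =
      C (c ^ k) * (derivative^[k] p).comp (C c * X + C d) := by
  induction k with
  | zero => simp
  | succ k ih =>
    rw [Function.iterate_succ_apply', ih, Function.iterate_succ_apply', derivative_C_mul]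
    simp [derivative_comp, pow_succ, mul_assoc]

theorem eval_iterate_derivative_eq_zero_of_pow_dvd {R : Type*} [CommRing R] {a : R} {w : R[X]}
    {k : ℕ} (h : (X - C a) ^ (k + 1) ∣ w) : (derivative^[k] w).eval a = 0 := by
  have h' := pow_sub_dvd_iterate_derivative_of_pow_dvd k h
  rw [Nat.add_sub_cancel_left, pow_one] at h'
  exact dvd_iff_isRoot.mp h'

theorem integral_mul_iterate_derivative_eq_zero {a b : ℝ} {k : ℕ} {w p : ℝ[X]}
    (ha : (X - C a) ^ k ∣ w) (hb : (X - C b) ^ k ∣ w) (hp : p.degree < k) :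
    ∫ x in a..b, p.eval x * (derivative^[k] w).eval x = 0 := by
  induction k generalizing p with
  | zero =>
    have : p = 0 := by simpa [Nat.WithBot.lt_zero_iff] using hp
    simp [this]
  | succ k ih =>
    have hp' : (derivative p).degree < k := by
      by_cases h0 : p = 0
      · simp [h0]
      · have h1 := degree_derivative_lt h0
        have h2 : p.degree ≤ k := degree_le_of_natDegree_le <|
          Nat.le_of_lt_succ ((natDegree_lt_iff_degree_lt h0).mpr hp)
        exact h1.trans_le h2
    rw [intervalIntegral.integral_mul_deriv_eq_deriv_mul
        (u := fun x => p.eval x) (u' := fun x => (derivative p).eval x)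
        (v := fun x => (derivative^[k] w).eval x) (fun x _ => p.hasDerivAt x)
        (fun x _ => by
          rw [Function.iterate_succ_apply']
          exact (derivative^[k] w).hasDerivAt x)
        ((Polynomial.continuous _).intervalIntegrable _ _)
        ((Polynomial.continuous _).intervalIntegrable _ _),
      ih ((pow_dvd_pow _ k.le_succ).trans ha) ((pow_dvd_pow _ k.le_succ).trans hb) hp',
      eval_iterate_derivative_eq_zero_of_pow_dvd ha, eval_iterate_derivative_eq_zero_of_pow_dvd hb]
    simp

theorem integral_mul_shiftedLegendre_eq_zero {τ : ℝ} (hτ : 0 < τ) {N : ℕ} {p : ℝ[X]}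
    (hp : p.degree < N) :
    ∫ x in (-τ)..(0 : ℝ), p.eval x * (_root_.shiftedLegendre τ N).eval x = 0 := by
  set w : ℝ[X] := ((X ^ 2 - 1 : ℝ[X]) ^ N).comp (C (2 / τ) * X + C 1) with hw
  have hdvd (a : ℝ) (h : (2 / τ * a + 1) ^ 2 = 1) : (X - C a) ^ N ∣ w := by
    rw [hw, pow_comp]
    refine pow_dvd_pow_of_dvd (dvd_iff_isRoot.mpr ?_) N
    simp [h]
  have key := integral_mul_iterate_derivative_eq_zero
    (hdvd (-τ) (by field_simp; norm_num)) (hdvd 0 (by norm_num)) hp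
  rw [hw, iterate_derivative_comp_linear] at key
  simp only [eval_mul, eval_C, mul_left_comm _ ((2 / τ) ^ N)] at key
  rw [intervalIntegral.integral_const_mul] at key
  have key' := (mul_eq_zero.mp key).resolve_left (by positivity)
  simp only [_root_.shiftedLegendre, mul_comp, C_comp, eval_mul, eval_C, mul_left_comm _ (_⁻¹)]
  rw [intervalIntegral.integral_const_mul, key', mul_zero]

theorem hasDerivAt_legendreTauIntOp (τ : ℝ) (N : ℕ) {f : ℝ → ℝ} (hf : Continuous f) (θ : ℝ) :
    HasDerivAt (legendreTauIntOp τ N f)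
      (f θ - ((∫ x in (-τ)..(0 : ℝ), f x * (_root_.shiftedLegendre τ N).eval x) /
        (∫ x in (-τ)..(0 : ℝ), (_root_.shiftedLegendre τ N).eval x * (_root_.shiftedLegendre τ N).eval x)) *
      (_root_.shiftedLegendre τ N).eval θ) θ :=
  (hf.sub (continuous_const.mul (_root_.shiftedLegendre τ N).continuous)).integral_hasStrictDerivAt
    0 θ |>.hasDerivAt

theorem continuous_legendreTauIntOp_iterate (τ : ℝ) (N n : ℕ) :
    Continuous ((legendreTauIntOp τ N)^[n] fun _ => 1) := by
  induction n with
  | zero => exact continuous_const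
  | succ n ih =>
    rw [Function.iterate_succ_apply']
    exact continuous_iff_continuousAt.mpr fun θ =>
      (hasDerivAt_legendreTauIntOp τ N ih θ).continuousAt

theorem hasDerivAt_add_pow_div_factorial (c : ℝ) (a : ℕ) (x : ℝ) :
    HasDerivAt (fun x : ℝ => (x + c) ^ (a + 1) / (a + 1).factorial)
      ((x + c) ^ a / a.factorial) x := by
  refine ((((hasDerivAt_id x).add_const c).pow (a + 1)).div_const
    ((a + 1).factorial : ℝ)).congr_deriv ?_
  rw [Nat.factorial_succ]
  push_cast
  simp only [id]
  field_simp

theorem hasDerivAt_pow_div_factorial (a : ℕ) (x : ℝ) :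
    HasDerivAt (fun x : ℝ => x ^ (a + 1) / (a + 1).factorial) (x ^ a / a.factorial) x := by
  simpa using hasDerivAt_add_pow_div_factorial 0 a x

theorem integral_add_pow_div_factorial_mul {τ : ℝ} {F f : ℝ → ℝ} (hF : ∀ x, HasDerivAt F (f x) x)
    (hf : Continuous f) (hF0 : F 0 = 0) (a : ℕ) :
    ∫ x in (-τ)..(0 : ℝ), (x + τ) ^ a / a.factorial * F x =
      -∫ x in (-τ)..(0 : ℝ), (x + τ) ^ (a + 1) / (a + 1).factorial * f x := by
  rw [intervalIntegral.integral_mul_deriv_eq_deriv_mul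
    (u' := fun x => (x + τ) ^ a / a.factorial)
    (fun x _ => hasDerivAt_add_pow_div_factorial τ a x) (fun x _ => hF x)
    (Continuous.intervalIntegrable (by fun_prop) _ _) (hf.intervalIntegrable _ _), hF0]
  simp

theorem integral_mul_sub_shiftedLegendre {τ : ℝ} (hτ : 0 < τ) {N : ℕ} {p : ℝ[X]}
    (hp : p.degree < N) {f : ℝ → ℝ} (hf : Continuous f) (c : ℝ) :
    ∫ x in (-τ)..(0 : ℝ), p.eval x * (f x - c * (_root_.shiftedLegendre τ N).eval x) =
      ∫ x in (-τ)..(0 : ℝ), p.eval x * f x := by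
  simp only [mul_sub, mul_left_comm _ c]
  rw [intervalIntegral.integral_sub (Continuous.intervalIntegrable (by fun_prop) _ _)
    (Continuous.intervalIntegrable (by fun_prop) _ _), intervalIntegral.integral_const_mul,
    integral_mul_shiftedLegendre_eq_zero hτ hp, mul_zero, sub_zero]

theorem legendreTauIntOp_iterate_of_le {τ : ℝ} (hτ : 0 < τ) {N n : ℕ} (hn : n ≤ N) :
    (legendreTauIntOp τ N)^[n] (fun _ => 1) = fun x : ℝ => x ^ n / (n.factorial : ℝ) := by
  induction n with
  | zero => simp
  | succ n ih =>
    rw [Function.iterate_succ_apply', ih (by omega)]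
    funext θ
    have hp : (C ((n.factorial : ℝ)⁻¹) * X ^ n).degree < (N : WithBot ℕ) :=
      (degree_C_mul_X_pow_le n _).trans_lt (Nat.cast_lt.mpr hn)
    have h0 : ∫ x in (-τ)..(0 : ℝ), x ^ n / n.factorial * (_root_.shiftedLegendre τ N).eval x = 0 := by
      simpa [div_eq_inv_mul] using integral_mul_shiftedLegendre_eq_zero hτ hp
    simp only [legendreTauIntOp, h0, zero_div, zero_mul, sub_zero]
    rw [intervalIntegral.integral_eq_sub_of_hasDerivAt
      (fun x _ => hasDerivAt_pow_div_factorial n x)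
      (Continuous.intervalIntegrable (by fun_prop) _ _)]
    simp

theorem integral_add_pow_mul_legendreTauIntOp {τ : ℝ} (hτ : 0 < τ) {N a : ℕ} (ha : a + 1 < N)
    {f : ℝ → ℝ} (hf : Continuous f) :
    ∫ x in (-τ)..(0 : ℝ), (x + τ) ^ a / a.factorial * legendreTauIntOp τ N f x =
      -∫ x in (-τ)..(0 : ℝ), (x + τ) ^ (a + 1) / (a + 1).factorial * f x := by
  rw [integral_add_pow_div_factorial_mul (hasDerivAt_legendreTauIntOp τ N hf) (by fun_prop)
    (by simp [legendreTauIntOp])]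
  have hp : (C ((a + 1).factorial : ℝ)⁻¹ * (X + C τ) ^ (a + 1)).degree < (N : WithBot ℕ) := by
    rw [degree_C_mul (by positivity), degree_pow, degree_X_add_C]
    simpa using (Nat.cast_lt (α := WithBot ℕ)).mpr ha
  congr 1
  simpa [div_eq_inv_mul] using integral_mul_sub_shiftedLegendre hτ hp hf
    ((∫ x in (-τ)..(0 : ℝ), f x * (_root_.shiftedLegendre τ N).eval x) /
      (∫ x in (-τ)..(0 : ℝ), (_root_.shiftedLegendre τ N).eval x * (_root_.shiftedLegendre τ N).eval x))

theorem integral_add_pow_mul_legendreTauIntOp_iterate {τ : ℝ} (hτ : 0 < τ) {N a b : ℕ}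
    (ha : a < N) (hab : a + b < 2 * N) :
    ∫ x in (-τ)..(0 : ℝ), (x + τ) ^ a / a.factorial *
        (legendreTauIntOp τ N)^[b] (fun _ => 1) x =
      ∫ x in (-τ)..(0 : ℝ), (x + τ) ^ a / a.factorial * (x ^ b / b.factorial) := by
  induction b generalizing a with
  | zero => simp
  | succ b ih =>
    rcases le_or_gt (b + 1) N with hb | hb
    · rw [legendreTauIntOp_iterate_of_le hτ hb]
    · rw [Function.iterate_succ_apply', integral_add_pow_mul_legendreTauIntOp hτ (by omega)
        (continuous_legendreTauIntOp_iterate τ N b), ih (by omega) (by omega),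
        integral_add_pow_div_factorial_mul (hasDerivAt_pow_div_factorial b) (by fun_prop)
          (by simp)]

theorem legendreTauIntOp_apply_neg {τ : ℝ} (hτ : 0 < τ) {N : ℕ} (hN : 1 ≤ N) {f : ℝ → ℝ}
    (hf : Continuous f) :
    legendreTauIntOp τ N f (-τ) = -∫ x in (-τ)..(0 : ℝ), f x := by
  have hp : (1 : ℝ[X]).degree < N := by
    rw [degree_one]
    exact_mod_cast hN
  rw [legendreTauIntOp, intervalIntegral.integral_symm]
  congr 1
  simpa using integral_mul_sub_shiftedLegendre hτ hp hf
    ((∫ x in (-τ)..(0 : ℝ), f x * (_root_.shiftedLegendre τ N).eval x) /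
      (∫ x in (-τ)..(0 : ℝ), (_root_.shiftedLegendre τ N).eval x * (_root_.shiftedLegendre τ N).eval x))

/-- For `N ≥ 1` and every `0 ≤ n ≤ 2N`, the `n`-fold iterate of `M_N`
applied to the constant polynomial `1` satisfies `n!·(M_N^n 1)(-τ) = (-τ)^n`. -/
theorem legendre_tau_moment_identity (τ : ℝ) (hτ : 0 < τ) (N : ℕ) (hN : 1 ≤ N)
    (n : ℕ) (hn : n ≤ 2 * N) :
    (n.factorial : ℝ) * ((legendreTauIntOp τ N)^[n] (fun _ => 1)) (-τ) = (-τ) ^ n := by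
  cases n with
  | zero => simp
  | succ n =>
    have h := integral_add_pow_mul_legendreTauIntOp_iterate hτ (a := 0) (b := n) hN (by omega)
    simp only [pow_zero, Nat.factorial_zero, Nat.cast_one, div_one, one_mul] at h
    rw [Function.iterate_succ_apply',
      legendreTauIntOp_apply_neg hτ hN (continuous_legendreTauIntOp_iterate τ N n), h,
      intervalIntegral.integral_eq_sub_of_hasDerivAt
        (fun x _ => hasDerivAt_pow_div_factorial n x)
        (Continuous.intervalIntegrable (by fun_prop) _ _)]
    have : ((n + 1).factorial : ℝ) ≠ 0 := by positivity
    simp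
    field_simp
end

section
/- Let N ≥ 1 be an integer and define the integration operator I on real polynomials by (I f)(θ) = ∫_0^θ f(ξ) dξ. Then for every integer m with 0 ≤ m < N, the m-fold iterated integral satisfies (I^m (P_{N+1} − P_{N−1}))(−τ) = 0. -/
open Polynomial

/-- The integration operator `I`: `(I f)(θ) = ∫_0^θ f(ξ) dξ`. -/
noncomputable def integOp (f : ℝ → ℝ) : ℝ → ℝ :=
  fun θ => ∫ ξ in (0 : ℝ)..θ, f ξ

theorem eval_iterate_derivative_pow_eq_zero {R : Type*} [CommRing R] {p : R[X]} {x : R}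
    (hx : p.eval x = 0) {i n : ℕ} (hi : i < n) : (derivative^[i] (p ^ n)).eval x = 0 := by
  have h := pow_sub_dvd_iterate_derivative_of_pow_dvd i (dvd_refl (p ^ n))
  refine eval_eq_zero_of_dvd_of_eval_eq_zero h ?_
  rw [eval_pow, hx, zero_pow (by omega)]

theorem integOp_eval_derivative {a : ℝ} (ha : a ≠ 0) (c b : ℝ) (p : ℝ[X]) (hp : p.eval b = 0) :
    integOp (fun θ => c * (derivative p).eval (a * θ + b)) =
      fun θ => c * a⁻¹ * p.eval (a * θ + b) := by
  funext θ
  have hderiv : ∀ ξ, HasDerivAt (fun θ => c * a⁻¹ * p.eval (a * θ + b))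
      (c * (derivative p).eval (a * ξ + b)) ξ := fun ξ => by
    have hlin : HasDerivAt (fun θ => a * θ + b) a ξ := by
      simpa using ((hasDerivAt_id ξ).const_mul a).add_const b
    refine (((p.hasDerivAt (a * ξ + b)).comp ξ hlin).const_mul (c * a⁻¹)).congr_deriv ?_
    field_simp
  have hcont : Continuous fun ξ => c * (derivative p).eval (a * ξ + b) := by fun_prop
  simp only [integOp]
  rw [intervalIntegral.integral_eq_sub_of_hasDerivAt (fun ξ _ => hderiv ξ)
    (hcont.intervalIntegrable _ _)]
  simp [hp]

theorem iterate_integOp_eval_iterate_derivative {a : ℝ} (ha : a ≠ 0) (b : ℝ) (p : ℝ[X]) (m : ℕ)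
    (hp : ∀ i < m, (derivative^[i] p).eval b = 0) (c : ℝ) :
    integOp^[m] (fun θ => c * (derivative^[m] p).eval (a * θ + b)) =
      fun θ => c * a⁻¹ ^ m * p.eval (a * θ + b) := by
  induction m generalizing c with
  | zero => simp
  | succ m ih =>
    rw [Function.iterate_succ_apply, Function.iterate_succ_apply',
      integOp_eval_derivative ha _ _ _ (hp m m.lt_succ_self),
      ih (fun i hi => hp i (hi.trans m.lt_succ_self))]
    funext θ
    ring

/-- Rodrigues' formula for the difference of Legendre polynomials two degrees apart. -/
theorem legendre_sub_legendre (n : ℕ) :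
    C (((2 : ℝ) ^ (n + 2) * (n + 2).factorial)⁻¹) * derivative^[n + 2] ((X ^ 2 - 1) ^ (n + 2)) -
        C (((2 : ℝ) ^ n * n.factorial)⁻¹) * derivative^[n] ((X ^ 2 - 1) ^ n) =
      C ((2 * n + 3) * ((2 : ℝ) ^ (n + 1) * (n + 1).factorial)⁻¹) *
        derivative^[n] ((X ^ 2 - 1) ^ (n + 1)) := by
  have hsecond : derivative^[2] ((X ^ 2 - 1 : ℝ[X]) ^ (n + 2)) =
      C (2 * (n + 2) * (2 * n + 3) : ℝ) * (X ^ 2 - 1) ^ (n + 1) +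
        C (4 * (n + 1) * (n + 2) : ℝ) * (X ^ 2 - 1) ^ n := by
    simp [derivative_pow, C_ofNat]
    ring
  rw [Function.iterate_add_apply, hsecond, iterate_map_add, iterate_derivative_C_mul,
    iterate_derivative_C_mul, mul_add, ← mul_assoc, ← mul_assoc, ← C_mul, ← C_mul]
  have h₁ : ((2 : ℝ) ^ (n + 2) * (n + 2).factorial)⁻¹ * (2 * (n + 2) * (2 * n + 3)) =
      (2 * n + 3) * ((2 : ℝ) ^ (n + 1) * (n + 1).factorial)⁻¹ := by
    rw [Nat.factorial_succ (n + 1), Nat.factorial_succ n]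
    push_cast
    field_simp
    ring
  have h₂ : ((2 : ℝ) ^ (n + 2) * (n + 2).factorial)⁻¹ * (4 * (n + 1) * (n + 2)) =
      ((2 : ℝ) ^ n * n.factorial)⁻¹ := by
    rw [Nat.factorial_succ (n + 1), Nat.factorial_succ n]
    push_cast
    field_simp
    ring
  rw [h₁, h₂, add_sub_cancel_right]

/-- For `N ≥ 1` and every `0 ≤ m < N`, the `m`-fold iterated integral of
`P_{N+1} - P_{N-1}` vanishes at `-τ`. -/
theorem iterated_integral_legendre_difference_vanishes (τ : ℝ) (hτ : 0 < τ)
    (N : ℕ) (hN : 1 ≤ N) (m : ℕ) (hm : m < N) :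
    (integOp^[m] fun θ =>
        (shiftedLegendre τ (N + 1)).eval θ - (shiftedLegendre τ (N - 1)).eval θ) (-τ) = 0 := by
  obtain ⟨n, rfl⟩ := Nat.exists_eq_add_of_le' hN
  obtain ⟨j, rfl⟩ := Nat.exists_eq_add_of_le' (Nat.lt_succ_iff.mp hm)
  have ha : 2 / τ ≠ 0 := by positivity
  have hzero : ∀ x : ℝ, x ^ 2 = 1 → ∀ i < j + m + 1,
      (derivative^[i] ((X ^ 2 - 1 : ℝ[X]) ^ (j + m + 1))).eval x = 0 := fun x hx i hi =>
    eval_iterate_derivative_pow_eq_zero (by simp [hx]) hi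
  have hfun : (fun θ => (_root_.shiftedLegendre τ (j + m + 1 + 1)).eval θ -
      (_root_.shiftedLegendre τ (j + m + 1 - 1)).eval θ) = fun θ =>
        (2 * (j + m : ℕ) + 3) * ((2 : ℝ) ^ (j + m + 1) * (j + m + 1).factorial)⁻¹ *
          (derivative^[m] (derivative^[j] ((X ^ 2 - 1) ^ (j + m + 1)))).eval (2 / τ * θ + 1) := by
    funext θ
    have h := congrArg (eval (2 / τ * θ + 1)) (legendre_sub_legendre (j + m))
    rw [← Function.iterate_add_apply, add_comm m j]
    simpa only [_root_.shiftedLegendre, eval_comp, eval_sub, eval_add, eval_mul, eval_C, eval_X,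
      Nat.add_sub_cancel] using h
  rw [hfun, iterate_integOp_eval_iterate_derivative ha]
  · have hleft : 2 / τ * -τ + 1 = -1 := by
      field_simp
      norm_num
    beta_reduce
    rw [hleft, hzero (-1) (by norm_num) j (by omega), mul_zero]
  · intro i hi
    rw [← Function.iterate_add_apply]
    exact hzero 1 (by norm_num) _ (by omega)
end

section
/- Let W be an (N+1)×(N+1) complex matrix, with rows and columns indexed by 0, …, N, such that W_{jk} = W_{kj} for all j, k and W_{j+1,k} = −W_{j,k+1} for all 0 ≤ j ≤ N−1 and 0 ≤ k ≤ N−1. Define the bivariate polynomial U(θ, θ′) = Σ_{j=0}^N Σ_{k=0}^N W_{jk}·φ^{(N−j)}(θ)·φ^{(N−k)}(θ′). Then U(θ, θ′) = U(−τ − θ, −τ − θ′) for all θ, θ′ ∈ ℝ. -/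
open Polynomial

theorem eval_derivative_sub_of_eval_sub {R : Type*} [CommRing R] [IsDomain R] [Infinite R]
    {p : R[X]} {a c : R} (h : ∀ x, p.eval (a - x) = c * p.eval x) (x : R) :
    (derivative p).eval (a - x) = -c * (derivative p).eval x := by
  have hcomp : p.comp (C a - X) = C c * p := Polynomial.funext fun y => by simp [h]
  have hd := congrArg (fun q => (derivative q).eval x) hcomp
  simp [derivative_comp] at hd
  linear_combination -hd

theorem eval_iterate_derivative_sub_of_eval_sub {R : Type*} [CommRing R] [IsDomain R]
    [Infinite R] {p : R[X]} {a c : R} (h : ∀ x, p.eval (a - x) = c * p.eval x) (m : ℕ) (x : R) :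
    (derivative^[m] p).eval (a - x) = (-1) ^ m * c * (derivative^[m] p).eval x := by
  induction m generalizing x with
  | zero => simpa using h x
  | succ m ih =>
    rw [Function.iterate_succ_apply', eval_derivative_sub_of_eval_sub ih]
    ring

theorem Matrix.apply_add_left_of_alternating {R : Type*} [Ring R] {N : ℕ}
    {W : Matrix (Fin (N + 1)) (Fin (N + 1)) R}
    (hW : ∀ j k : Fin N, W j.succ k.castSucc = -W j.castSucc k.succ) (d j k : ℕ)
    (hj : j + d < N + 1) (hk : k + d < N + 1) :
    W ⟨j + d, hj⟩ ⟨k, by omega⟩ = (-1) ^ d * W ⟨j, by omega⟩ ⟨k + d, hk⟩ := by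
  induction d generalizing k with
  | zero => simp
  | succ d ih =>
    have hstep := hW ⟨j + d, by omega⟩ ⟨k, by omega⟩
    have hrest := ih (k + 1) (by omega) (by omega)
    simp only [Fin.succ_mk, Fin.castSucc_mk] at hstep
    simp only [← add_assoc, hstep, hrest, pow_succ, add_right_comm k 1 d]
    simp

theorem Matrix.apply_eq_zero_of_symm_of_alternating {R : Type*} [Ring R] [NoZeroDivisors R]
    [CharZero R] {N : ℕ} {W : Matrix (Fin (N + 1)) (Fin (N + 1)) R}
    (hsymm : ∀ j k, W j k = W k j)
    (hW : ∀ j k : Fin N, W j.succ k.castSucc = -W j.castSucc k.succ)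
    (j k : Fin (N + 1)) (hodd : Odd ((j : ℕ) + k)) : W j k = 0 := by
  wlog hjk : j ≤ k generalizing j k
  · rw [hsymm]
    exact this k j (by rwa [add_comm]) (le_of_not_ge hjk)
  obtain ⟨j, hj⟩ := j
  obtain ⟨k, hk⟩ := k
  obtain ⟨d, rfl⟩ := Nat.exists_eq_add_of_le (Fin.mk_le_mk.mp hjk)
  have hd : Odd d := by
    simp only at hodd
    grind
  have h := Matrix.apply_add_left_of_alternating hW d j j hk hk
  rw [hsymm, hd.neg_one_pow, neg_one_mul] at h
  exact self_eq_neg.mp h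

/-- Let `φ` be a real polynomial of degree `N ≥ 1` with the symmetry
`φ(-τ-θ) = (-1)^N φ(θ)`, and let `W` be an `(N+1)×(N+1)` complex matrix which is symmetric
and satisfies `W_{j+1,k} = -W_{j,k+1}` on anti-diagonals. Then the bivariate polynomial
`U(θ, θ') = ∑_{j,k} W_{jk} φ^{(N-j)}(θ) φ^{(N-k)}(θ')` satisfies
`U(θ, θ') = U(-τ-θ, -τ-θ')` for all real `θ, θ'`. -/
theorem lyapunov_reversal_symmetry (τ : ℝ) (hτ : 0 < τ) (N : ℕ) (hN : 1 ≤ N)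
    (φ : Polynomial ℝ) (hdeg : φ.natDegree = N)
    (hsym : ∀ θ : ℝ, φ.eval (-τ - θ) = (-1) ^ N * φ.eval θ)
    (W : Matrix (Fin (N + 1)) (Fin (N + 1)) ℂ)
    (hWsymm : ∀ j k, W j k = W k j)
    (hWanti : ∀ j k : Fin N, W j.succ k.castSucc = -W j.castSucc k.succ)
    (θ θ' : ℝ) :
    (∑ j : Fin (N + 1), ∑ k : Fin (N + 1),
        W j k * (((derivative^[N - (j : ℕ)] φ).eval θ : ℝ) : ℂ) *
          (((derivative^[N - (k : ℕ)] φ).eval θ' : ℝ) : ℂ))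
      = ∑ j : Fin (N + 1), ∑ k : Fin (N + 1),
          W j k * (((derivative^[N - (j : ℕ)] φ).eval (-τ - θ) : ℝ) : ℂ) *
            (((derivative^[N - (k : ℕ)] φ).eval (-τ - θ') : ℝ) : ℂ) := by
  have hφ : ∀ (j : Fin (N + 1)) (x : ℝ), (derivative^[N - (j : ℕ)] φ).eval (-τ - x)
      = (-1) ^ (j : ℕ) * (derivative^[N - (j : ℕ)] φ).eval x := by
    intro j x
    rw [eval_iterate_derivative_sub_of_eval_sub hsym, ← pow_add]
    congr 1
    exact neg_one_pow_congr (by grind)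
  refine Finset.sum_congr rfl fun j _ => Finset.sum_congr rfl fun k _ => ?_
  rw [hφ, hφ]
  rcases Nat.even_or_odd ((j : ℕ) + k) with he | ho
  · have hsign : (-1 : ℂ) ^ (j : ℕ) * (-1) ^ (k : ℕ) = 1 := by rw [← pow_add, he.neg_one_pow]
    push_cast
    linear_combination -(W j k * (((derivative^[N - (j : ℕ)] φ).eval θ : ℝ) : ℂ) *
      (((derivative^[N - (k : ℕ)] φ).eval θ' : ℝ) : ℂ)) * hsign
  · simp [Matrix.apply_eq_zero_of_symm_of_alternating hWsymm hWanti j k ho]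
end

section
/- Let N be a natural number and let W be an (N+1)×(N+1) complex matrix, with rows and columns indexed by 0, …, N, such that W_{jk} = W_{kj} for all j, k and W_{j+1,k} = −W_{j,k+1} for all 0 ≤ j ≤ N−1 and 0 ≤ k ≤ N−1. Then W_{jk} = 0 whenever j + k is odd. -/
/-- Moving `d` steps along an anti-diagonal multiplies the entry by `(-1) ^ d`. -/
theorem antidiagonal_shift {R : Type*} [Ring R] {N : ℕ}
    (W : Matrix (Fin (N + 1)) (Fin (N + 1)) R)
    (hW : ∀ j k : Fin N, W j.succ k.castSucc = -W j.castSucc k.succ)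
    (d j k : ℕ) (hj : j + d < N + 1) (hk : k + d < N + 1) :
    W ⟨j + d, hj⟩ ⟨k, by omega⟩ = (-1) ^ d * W ⟨j, by omega⟩ ⟨k + d, hk⟩ := by
  induction d generalizing k with
  | zero => simp
  | succ d ih =>
    have step : W ⟨j + (d + 1), hj⟩ ⟨k, by omega⟩ =
        -W ⟨j + d, by omega⟩ ⟨k + 1, by omega⟩ :=
      hW ⟨j + d, by omega⟩ ⟨k, by omega⟩
    have shift := ih (k + 1) (by omega) (by omega)
    simp only [show k + 1 + d = k + (d + 1) by omega] at shift
    rw [step, shift, pow_succ]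
    simp

/-- Let `W` be an `(N+1)×(N+1)` complex matrix which is symmetric
(`W_{jk} = W_{kj}`) and satisfies the anti-diagonal relation `W_{j+1,k} = -W_{j,k+1}`
for `0 ≤ j, k ≤ N-1`. Then `W_{jk} = 0` whenever `j + k` is odd. -/
theorem antidiagonal_alternating_symmetric_vanishes (N : ℕ)
    (W : Matrix (Fin (N + 1)) (Fin (N + 1)) ℂ)
    (hWsymm : ∀ j k, W j k = W k j)
    (hWanti : ∀ j k : Fin N, W j.succ k.castSucc = -W j.castSucc k.succ)
    (j k : Fin (N + 1)) (h : Odd ((j : ℕ) + (k : ℕ))) :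
    W j k = 0 := by
  wlog hjk : j ≤ k generalizing j k
  · rw [hWsymm]
    exact this k j (by rwa [add_comm]) (le_of_not_ge hjk)
  obtain ⟨j, hj⟩ := j
  obtain ⟨k, hk⟩ := k
  obtain ⟨d, rfl⟩ := Nat.exists_eq_add_of_le (Fin.mk_le_mk.mp hjk)
  have hd : Odd d := by
    simp only [Nat.odd_iff] at h ⊢
    omega
  have key := antidiagonal_shift W hWanti d j j hk hk
  rw [hd.neg_one_pow, neg_one_mul, hWsymm] at key
  exact self_eq_neg.mp key
end

section
/- Let a ∈ ℝ with a ≠ 0 and τ > 0, and define λ : [−τ, τ] → ℝ by λ(t) = (aτ − 2a|t| − 1)/(4a). Then λ satisfies the delay Lyapunov system: (i) λ′(t) + a(λ(t) + λ(t + τ)) = 0 for all t ∈ (−τ, 0); (ii) λ(−t) = λ(t) for all t ∈ [−τ, τ]; (iii) 2a(λ(0) + λ(τ)) = −1. In particular, λ(0) = (aτ − 1)/(4a). -/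
/-- The explicit solution `λ(t) = (aτ - 2a|t| - 1)/(4a)` of the scalar delay Lyapunov
equation for the system `ẋ(t) = a x(t) + a x(t - τ)`. -/
noncomputable def delayLyapunovSol (a τ : ℝ) (t : ℝ) : ℝ :=
  (a * τ - 2 * a * |t| - 1) / (4 * a)

/-- For `a ≠ 0` and `τ > 0`, the function
`λ(t) = (aτ - 2a|t| - 1)/(4a)` satisfies the delay Lyapunov system:
(i) `λ'(t) + a(λ(t) + λ(t + τ)) = 0` on `(-τ, 0)`;
(ii) `λ(-t) = λ(t)` on `[-τ, τ]`;
(iii) `2a(λ(0) + λ(τ)) = -1`;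
and in particular `λ(0) = (aτ - 1)/(4a)`. -/
theorem delay_lyapunov_explicit_solution (a τ : ℝ) (ha : a ≠ 0) (hτ : 0 < τ) :
    (∀ t ∈ Set.Ioo (-τ) 0,
      HasDerivAt (delayLyapunovSol a τ)
        (-(a * (delayLyapunovSol a τ t + delayLyapunovSol a τ (t + τ)))) t) ∧
    (∀ t ∈ Set.Icc (-τ) τ, delayLyapunovSol a τ (-t) = delayLyapunovSol a τ t) ∧
    (2 * a * (delayLyapunovSol a τ 0 + delayLyapunovSol a τ τ) = -1) ∧
    delayLyapunovSol a τ 0 = (a * τ - 1) / (4 * a) := by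
  refine ⟨fun t ht => ?_, fun t _ => by simp [delayLyapunovSol], ?_, by simp [delayLyapunovSol]⟩
  · have hd : HasDerivAt (fun s : ℝ => (a * τ - 2 * a * |s| - 1) / (4 * a))
        ((-(2 * a * -1)) / (4 * a)) t :=
      ((((hasDerivAt_abs_neg ht.2).const_mul (2 * a)).const_sub (a * τ)).sub_const 1).div_const _
    refine hd.congr_deriv ?_
    unfold delayLyapunovSol
    rw [abs_of_neg ht.2, abs_of_pos (show 0 < t + τ by linarith [ht.1])]
    field_simp
    ring
  · simp only [delayLyapunovSol, abs_zero, abs_of_pos hτ]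
    field_simp
    ring
end

section
/- Let a < 0, τ > 0, and let N ≥ 1 be an integer. A real polynomial μ of degree at most N satisfies both (i) the polynomial identity μ′(θ) = −a·[ν(θ) − (⟨ν, P_N⟩/⟨P_N, P_N⟩)·P_N(θ)], where ν is the polynomial ν(θ) = μ(θ) + μ(−τ − θ), and (ii) μ(0) + μ(−τ) = −1/(2a), if and only if μ(θ) = (aτ + 2aθ − 1)/(4a) for all θ. In particular, any such μ satisfies μ(0) = (aτ − 1)/(4a). -/
open Polynomial

/-- The reflected sum `ν(θ) = μ(θ) + μ(-τ - θ)`, as a polynomial. -/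
noncomputable def reflSum (τ : ℝ) (μ : Polynomial ℝ) : Polynomial ℝ :=
  μ + μ.comp (C (-τ) - X)

theorem iterate_derivative_comp_neg_X {R : Type*} [CommRing R] (p : R[X]) (k : ℕ) :
    derivative^[k] (p.comp (-X)) = (-1) ^ k * (derivative^[k] p).comp (-X) := by
  induction k generalizing p with
  | zero => simp
  | succ k ih =>
    have h : derivative (p.comp (-X)) = -(derivative p).comp (-X) := by
      simp [derivative_comp]
    rw [Function.iterate_succ_apply, h, iterate_derivative_neg, ih, Function.iterate_succ_apply]
    ring

/-- Parity of the shifted Legendre polynomials about the midpoint of `[-τ, 0]`. -/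
theorem shiftedLegendre_comp_reflection {τ : ℝ} (hτ : τ ≠ 0) (k : ℕ) :
    (_root_.shiftedLegendre τ k).comp (C (-τ) - X) =
      (-1) ^ k * _root_.shiftedLegendre τ k := by
  have hlin : (C (2 / τ) * X + C 1 : ℝ[X]).comp (C (-τ) - X) =
      (-X : ℝ[X]).comp (C (2 / τ) * X + C 1) := by
    have h : (C (2 / τ) * C τ : ℝ[X]) = 2 := by
      rw [← C_mul, div_mul_cancel₀ _ hτ]; rfl
    simp only [add_comp, mul_comp, C_comp, X_comp, neg_comp, C_neg, C_1, one_comp]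
    linear_combination -h
  have hpar : (derivative^[k] ((X ^ 2 - 1 : ℝ[X]) ^ k)).comp (-X) =
      (-1) ^ k * derivative^[k] ((X ^ 2 - 1 : ℝ[X]) ^ k) := by
    have h := iterate_derivative_comp_neg_X ((X ^ 2 - 1 : ℝ[X]) ^ k) k
    have hsq : ((-1 : ℝ[X]) ^ k) * (-1) ^ k = 1 := by
      rw [← mul_pow]; simp
    have he : ((X ^ 2 - 1 : ℝ[X]) ^ k).comp (-X) = (X ^ 2 - 1) ^ k := by simp
    rw [he] at h
    rw [h, ← mul_assoc, hsq, one_mul, ← h]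
  unfold _root_.shiftedLegendre
  rw [comp_assoc, hlin, ← comp_assoc, mul_comp, hpar]
  simp only [mul_comp, C_comp, pow_comp, neg_comp, one_comp]
  ring

/-- The shifted Legendre polynomials of positive degree are orthogonal to constants. -/
theorem integral_shiftedLegendre_eq_zero {τ : ℝ} (hτ : τ ≠ 0) {k : ℕ} (hk : 1 ≤ k) :
    ∫ θ in (-τ)..0, (_root_.shiftedLegendre τ k).eval θ = 0 := by
  obtain ⟨n, rfl⟩ : ∃ n, k = n + 1 := ⟨k - 1, by omega⟩
  set q : ℝ[X] := derivative^[n] ((X ^ 2 - 1) ^ (n + 1)) with hq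
  have hroot (x : ℝ) (hx : x ^ 2 = 1) : q.eval x = 0 := by
    have hd : (X ^ 2 - 1 : ℝ[X]) ∣ q := by
      have := pow_sub_dvd_iterate_derivative_of_pow_dvd n
        (dvd_refl ((X ^ 2 - 1 : ℝ[X]) ^ (n + 1)))
      simpa using this
    obtain ⟨r, hr⟩ := hd
    simp [hr, hx]
  set c : ℝ := ((2 : ℝ) ^ (n + 1) * (n + 1).factorial)⁻¹
  set F : ℝ[X] := C (τ / 2) * (C c * q).comp (C (2 / τ) * X + C 1) with hF
  have hder : derivative F = _root_.shiftedLegendre τ (n + 1) := by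
    have h : (C (τ / 2) * C (2 / τ) : ℝ[X]) = 1 := by
      rw [← C_mul, ← C_1]; congr 1; field_simp
    unfold _root_.shiftedLegendre
    rw [Function.iterate_succ_apply', ← hq, hF]
    simp only [derivative_mul, derivative_C, derivative_comp, derivative_add, derivative_X,
      zero_mul, zero_add, mul_one, add_zero, mul_comp, C_comp]
    linear_combination (C c * (derivative q).comp (C (2 / τ) * X + C 1)) * h
  rw [intervalIntegral.integral_eq_sub_of_hasDerivAt (f := fun θ => F.eval θ)
    (fun x _ => by simpa [hder] using F.hasDerivAt x)
    ((Polynomial.continuous _).intervalIntegrable _ _)]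
  have h0 := hroot 1 (by norm_num)
  have h1 := hroot (2 / τ * (-τ) + 1) (by field_simp; norm_num)
  have e0 : F.eval 0 = 0 := by simp [hF, eval_comp, h0]
  have e1 : F.eval (-τ) = 0 := by
    simp only [hF, eval_mul, eval_comp, eval_C, eval_add, eval_X, h1, mul_zero]
  rw [e0, e1, sub_zero]

theorem reflSum_comp_reflection (τ : ℝ) (μ : ℝ[X]) :
    (reflSum τ μ).comp (C (-τ) - X) = reflSum τ μ := by
  simp only [reflSum, add_comp, comp_assoc, sub_comp, C_comp, X_comp, sub_sub_cancel, comp_X]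
  ring

/-- A function that is odd about the midpoint of `[-τ, 0]` has zero integral there. -/
theorem integral_eq_zero_of_reflection_neg {τ : ℝ} {f : ℝ → ℝ}
    (hf : ∀ θ, f (-τ - θ) = -f θ) : ∫ θ in (-τ)..0, f θ = 0 := by
  have h := intervalIntegral.integral_comp_sub_left (a := -τ) (b := 0) f (-τ)
  simp only [hf, intervalIntegral.integral_neg, sub_zero, sub_self] at h
  linarith

theorem derivative_reflSum (τ : ℝ) (μ : ℝ[X]) :
    derivative (reflSum τ μ) = derivative μ - (derivative μ).comp (C (-τ) - X) := by
  simp only [reflSum, derivative_add, derivative_comp, derivative_sub, derivative_C, derivative_X]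
  ring

theorem eval_reflSum_zero (τ : ℝ) (μ : ℝ[X]) :
    (reflSum τ μ).eval 0 = μ.eval 0 + μ.eval (-τ) := by
  simp [reflSum]

theorem integral_const_reflSum_mul_shiftedLegendre {τ : ℝ} (hτ : τ ≠ 0) {N : ℕ} (hN : 1 ≤ N)
    {μ : ℝ[X]} {r : ℝ} (h : reflSum τ μ = C r) :
    ∫ θ in (-τ)..0, (reflSum τ μ).eval θ * (_root_.shiftedLegendre τ N).eval θ = 0 := by
  simp [h, integral_shiftedLegendre_eq_zero hτ hN]

/-- If `μ'` is `-a` times the reflected sum up to a multiple of its own Legendre component,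
then the reflected sum is constant. -/
theorem derivative_reflSum_eq_zero {a τ d : ℝ} (hτ : τ ≠ 0) {N : ℕ} {μ : ℝ[X]}
    (h : derivative μ = C (-a) * (reflSum τ μ -
      C ((∫ θ in (-τ)..0, (reflSum τ μ).eval θ * (_root_.shiftedLegendre τ N).eval θ) / d) *
        _root_.shiftedLegendre τ N)) :
    derivative (reflSum τ μ) = 0 := by
  have hP := shiftedLegendre_comp_reflection hτ N
  have hν := reflSum_comp_reflection τ μ
  rcases N.even_or_odd with hN | hN
  · rw [derivative_reflSum, h]
    simp only [mul_comp, sub_comp (p := reflSum τ μ), C_comp, hP, hν, hN.neg_one_pow, one_mul,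
      sub_self]
  · have hint :
        ∫ θ in (-τ)..0, (reflSum τ μ).eval θ * (_root_.shiftedLegendre τ N).eval θ = 0 := by
      refine integral_eq_zero_of_reflection_neg fun θ => ?_
      have h1 := congrArg (eval θ) hν
      have h2 := congrArg (eval θ) hP
      simp only [hN.neg_one_pow, eval_comp, eval_sub, eval_C, eval_X, eval_mul, eval_neg,
        eval_one] at h1 h2
      rw [h1, h2]
      ring
    rw [hint, zero_div, C_0, zero_mul, sub_zero] at h
    rw [derivative_reflSum, h, mul_comp, C_comp, hν, sub_self]

/-- For `a < 0`, `τ > 0`, `N ≥ 1`, a real polynomial `μ` of degree at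
most `N` satisfies (i) `μ' = -a·T_{N-1}ν` with `ν(θ) = μ(θ) + μ(-τ-θ)` (truncation w.r.t.
the shifted Legendre polynomial `P_N`) and (ii) `μ(0) + μ(-τ) = -1/(2a)`, if and only if
`μ(θ) = (aτ + 2aθ - 1)/(4a)`; in particular any such `μ` satisfies
`μ(0) = (aτ - 1)/(4a)` (super convergence of the discretized H²-norm). -/
theorem scalar_tau_lyapunov_superconvergence (a τ : ℝ) (ha : a < 0) (hτ : 0 < τ)
    (N : ℕ) (hN : 1 ≤ N) (μ : Polynomial ℝ) (hdeg : μ.natDegree ≤ N) :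
    ((derivative μ = C (-a) *
          (reflSum τ μ -
            C ((∫ θ in (-τ)..0, (reflSum τ μ).eval θ * (shiftedLegendre τ N).eval θ) /
                (∫ θ in (-τ)..0, (shiftedLegendre τ N).eval θ * (shiftedLegendre τ N).eval θ)) *
              shiftedLegendre τ N) ∧
        μ.eval 0 + μ.eval (-τ) = -1 / (2 * a))
      ↔ ∀ θ : ℝ, μ.eval θ = (a * τ + 2 * a * θ - 1) / (4 * a)) ∧
    ((derivative μ = C (-a) *
          (reflSum τ μ -
            C ((∫ θ in (-τ)..0, (reflSum τ μ).eval θ * (shiftedLegendre τ N).eval θ) /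
                (∫ θ in (-τ)..0, (shiftedLegendre τ N).eval θ * (shiftedLegendre τ N).eval θ)) *
              shiftedLegendre τ N) ∧
        μ.eval 0 + μ.eval (-τ) = -1 / (2 * a))
      → μ.eval 0 = (a * τ - 1) / (4 * a)) := by
  have hτ' : τ ≠ 0 := hτ.ne'
  have ha' : a ≠ 0 := ha.ne
  rw [and_iff_left_of_imp]
  · constructor
    · rintro ⟨hi, hii⟩
      have hconst : reflSum τ μ = C (-1 / (2 * a)) := by
        have h := eq_C_of_derivative_eq_zero (derivative_reflSum_eq_zero hτ' hi)
        have h0 := congrArg (eval 0) h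
        rw [eval_reflSum_zero, hii, eval_C] at h0
        rw [h, ← h0]
      rw [integral_const_reflSum_mul_shiftedLegendre hτ' hN hconst, hconst, zero_div, C_0,
        zero_mul, sub_zero, ← C_mul] at hi
      have hhalf : -a * (-1 / (2 * a)) = 1 / 2 := by field_simp
      rw [hhalf] at hi
      have hlin := eq_C_of_derivative_eq_zero (p := μ - C (1 / 2) * X) (by simp [hi])
      have hval (θ : ℝ) : μ.eval θ - 1 / 2 * θ = (μ - C (1 / 2) * X).coeff 0 := by
        simpa using congrArg (eval θ) hlin
      intro θ
      have h0 := hval 0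
      have h1 := hval (-τ)
      have h2 := hval θ
      have h3 : μ.eval θ = θ / 2 + τ / 4 + (-1 / (2 * a)) / 2 := by linarith
      rw [h3]
      field_simp
      ring
    · intro h
      have hμ : μ = C (1 / 2) * X + C ((a * τ - 1) / (4 * a)) := by
        refine Polynomial.funext fun θ => ?_
        rw [h θ]
        simp only [eval_add, eval_mul, eval_C, eval_X]
        field_simp
        ring
      have hconst : reflSum τ μ = C (-1 / (2 * a)) := by
        refine Polynomial.funext fun θ => ?_
        simp only [reflSum, eval_add, eval_comp, eval_sub, eval_C, eval_X, h]
        field_simp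
        ring
      refine ⟨?_, ?_⟩
      · rw [integral_const_reflSum_mul_shiftedLegendre hτ' hN hconst, hconst, zero_div, C_0,
          zero_mul, sub_zero, ← C_mul, hμ]
        simp only [derivative_add, derivative_mul, derivative_C, derivative_X, zero_mul, zero_add,
          mul_one, add_zero]
        congr 1
        field_simp
      · rw [← eval_reflSum_zero, hconst, eval_C]
  · intro key h
    rw [key.1 h 0, mul_zero, add_zero]
end
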